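/- Let u₀, v₀ : ℝ × ℝ → ℝ be C^∞ functions of (t,x) satisfying at every point the unperturbed system u₀_t + (1/2) v₀_{xx} + v₀ (u₀² + v₀²) = 0 and v₀_t − (1/2) u₀_{xx} − u₀ (u₀² + v₀²) = 0. Then the conservation law ∂_t[ x u₀ u₀_x − (1/2) v₀² ] + ∂_x[ −(u₀/2)(2 x u₀_t + v₀_x) + (v₀/2) u₀_x ] = 0 holds at every point. -/

import Mathlib

noncomputable def pt (f : ℝ × ℝ → ℝ) : ℝ × ℝ → ℝ := fun p => deriv (fun s => f (s, p.2)) p.1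
noncomputable def px (f : ℝ × ℝ → ℝ) : ℝ × ℝ → ℝ := fun p => deriv (fun y => f (p.1, y)) p.2

theorem hasDerivAt_pt {f : ℝ × ℝ → ℝ} (hf : Differentiable ℝ f) (p : ℝ × ℝ) :
    HasDerivAt (fun s => f (s, p.2)) (pt f p) p.1 := by
  have h : Differentiable ℝ fun s : ℝ => f (s, p.2) := by fun_prop
  exact (h p.1).hasDerivAt

theorem hasDerivAt_px {f : ℝ × ℝ → ℝ} (hf : Differentiable ℝ f) (p : ℝ × ℝ) :
    HasDerivAt (fun y => f (p.1, y)) (px f p) p.2 := by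
  have h : Differentiable ℝ fun y : ℝ => f (p.1, y) := by fun_prop
  exact (h p.2).hasDerivAt

theorem pt_eq_fderiv {f : ℝ × ℝ → ℝ} (hf : Differentiable ℝ f) :
    pt f = fun p => fderiv ℝ f p (1, 0) := by
  funext p
  exact ((hf p).hasFDerivAt.comp_hasDerivAt p.1
    ((hasDerivAt_id p.1).prodMk (hasDerivAt_const p.1 p.2))).deriv

theorem px_eq_fderiv {f : ℝ × ℝ → ℝ} (hf : Differentiable ℝ f) :
    px f = fun p => fderiv ℝ f p (0, 1) := by
  funext p
  exact ((hf p).hasFDerivAt.comp_hasDerivAt p.2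
    ((hasDerivAt_const p.2 p.1).prodMk (hasDerivAt_id p.2))).deriv

theorem differentiable_fderiv_of_contDiff_two {f : ℝ × ℝ → ℝ} (hf : ContDiff ℝ 2 f) :
    Differentiable ℝ (fderiv ℝ f) :=
  (hf.fderiv_right (m := 1) (by norm_num)).differentiable (by norm_num)

theorem differentiable_pt {f : ℝ × ℝ → ℝ} (hf : ContDiff ℝ 2 f) : Differentiable ℝ (pt f) := by
  rw [pt_eq_fderiv (hf.differentiable (by norm_num))]
  exact (differentiable_fderiv_of_contDiff_two hf).clm_apply (differentiable_const _)

theorem differentiable_px {f : ℝ × ℝ → ℝ} (hf : ContDiff ℝ 2 f) : Differentiable ℝ (px f) := by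
  rw [px_eq_fderiv (hf.differentiable (by norm_num))]
  exact (differentiable_fderiv_of_contDiff_two hf).clm_apply (differentiable_const _)

theorem pt_px_comm {f : ℝ × ℝ → ℝ} (hf : ContDiff ℝ 2 f) (p : ℝ × ℝ) :
    pt (px f) p = px (pt f) p := by
  have hd : Differentiable ℝ f := hf.differentiable (by norm_num)
  have h2 := differentiable_fderiv_of_contDiff_two hf
  have hsymm : IsSymmSndFDerivAt ℝ f p := hf.contDiffAt.isSymmSndFDerivAt (by simp)
  have hfd (v w : ℝ × ℝ) :
      fderiv ℝ (fun q => fderiv ℝ f q v) p w = fderiv ℝ (fderiv ℝ f) p w v := by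
    rw [fderiv_clm_apply (h2 p) (differentiableAt_const v)]
    simp
  rw [pt_eq_fderiv (differentiable_px hf), px_eq_fderiv (differentiable_pt hf),
    pt_eq_fderiv hd, px_eq_fderiv hd]
  simp only [hfd]
  exact hsymm.eq _ _

theorem stmt14 (u₀ v₀ : ℝ × ℝ → ℝ)
    (hu₀ : ContDiff ℝ (⊤ : ℕ∞) u₀) (hv₀ : ContDiff ℝ (⊤ : ℕ∞) v₀)
    (h1 : ∀ p : ℝ × ℝ, pt u₀ p + (1 / 2) * px (px v₀) p + v₀ p * ((u₀ p) ^ 2 + (v₀ p) ^ 2) = 0)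
    (h2 : ∀ p : ℝ × ℝ, pt v₀ p - (1 / 2) * px (px u₀) p - u₀ p * ((u₀ p) ^ 2 + (v₀ p) ^ 2) = 0) :
    ∀ p : ℝ × ℝ,
      pt (fun q => q.2 * u₀ q * px u₀ q - (1 / 2) * (v₀ q) ^ 2) p
      + px (fun q => -(u₀ q / 2) * (2 * q.2 * pt u₀ q + px v₀ q) + (v₀ q / 2) * px u₀ q) p = 0 := by
  intro p
  have hu2 : ContDiff ℝ 2 u₀ := contDiff_infty.1 hu₀ 2
  have hv2 : ContDiff ℝ 2 v₀ := contDiff_infty.1 hv₀ 2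
  have hu : Differentiable ℝ u₀ := hu2.differentiable (by norm_num)
  have hv : Differentiable ℝ v₀ := hv2.differentiable (by norm_num)
  have ht := (((hasDerivAt_pt hu p).const_mul p.2).mul
    (hasDerivAt_pt (differentiable_px hu2) p)).sub
    (((hasDerivAt_pt hv p).pow 2).const_mul (1 / 2))
  have hx := (((hasDerivAt_px hu p).div_const 2).neg.mul
    ((((hasDerivAt_id p.2).const_mul 2).mul (hasDerivAt_px (differentiable_pt hu2) p)).add
      (hasDerivAt_px (differentiable_px hv2) p))).add
    (((hasDerivAt_px hv p).div_const 2).mul (hasDerivAt_px (differentiable_px hu2) p))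
  have et : pt (fun q => q.2 * u₀ q * px u₀ q - (1 / 2) * (v₀ q) ^ 2) p = _ := ht.deriv
  have ex : px (fun q => -(u₀ q / 2) * (2 * q.2 * pt u₀ q + px v₀ q) + (v₀ q / 2) * px u₀ q) p
      = _ := hx.deriv
  rw [et, ex, pt_px_comm hu2]
  simp only [Prod.mk.eta, id, Pi.mul_apply, Pi.add_apply, Pi.neg_apply]
  push_cast
  linear_combination (-u₀ p) * h1 p - v₀ p * h2 p
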